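/- arXiv:2411.10553 — 4 statements merged into one kernel-verified Lean document; each statement's English description precedes it below -/
import Mathlib

section
/- For every integer N ≥ 2 with σ_N < ∞ and every z ∈ ℂ satisfying Re z ≥ μ_N − (μ_N − μ_{N−1})/2 and |z − μ_k| ≥ r_k for all k ∈ ℕ, one has Σ_{j=1}^∞ ω_j²/|z − μ_j| ≤ 2 σ_N. -/
open scoped ENNReal

/-- The quantity `σ_N = sup_{n ≥ N} ( Σ_{j ≠ n} ω_j²/|μ_n − μ_j| + ω_n²/r_n )`,
with indices running over positive integers, valued in `[0,∞]`. -/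
noncomputable def sigmaN (μ ω r : ℕ → ℝ) (N : ℕ) : ℝ≥0∞ :=
  ⨆ n, ⨆ (_ : N ≤ n),
    ((∑' j : ℕ, if 1 ≤ j ∧ j ≠ n then ENNReal.ofReal (ω j ^ 2 / |μ n - μ j|) else 0)
      + ENNReal.ofReal (ω n ^ 2 / r n))

/-- A sequence tending to infinity has, among the indices `n ≥ N`, a term nearest to `x`. -/
lemma exists_nearest_of_tendsto_atTop {μ : ℕ → ℝ}
    (hμ : Filter.Tendsto μ Filter.atTop Filter.atTop) (N : ℕ) (x : ℝ) :
    ∃ n, N ≤ n ∧ ∀ j, N ≤ j → |x - μ n| ≤ |x - μ j| := by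
  have hf : Filter.Tendsto (fun k => |x - μ (k + N)|) Filter.cofinite Filter.atTop := by
    rw [Nat.cofinite_eq_atTop]
    refine Filter.tendsto_atTop_mono (fun k => ?_)
      (Filter.tendsto_atTop_add_const_right _ (-x) (hμ.comp (Filter.tendsto_add_atTop_nat N)))
    rw [abs_sub_comm]
    exact le_abs_self _
  obtain ⟨k, hk⟩ := hf.exists_forall_le
  refine ⟨k + N, Nat.le_add_left N k, fun j hj => ?_⟩
  simpa [Nat.sub_add_cancel hj] using hk (j - N)

theorem statement0 (μ ω r : ℕ → ℝ)
    (hμ1 : 0 < μ 1)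
    (hμmono : ∀ n, 1 ≤ n → μ n < μ (n + 1))
    (hμtop : Filter.Tendsto μ Filter.atTop Filter.atTop)
    (hr1 : r 1 = (μ 2 - μ 1) / 2)
    (hrn : ∀ n, 2 ≤ n → r n = min (μ n - μ (n - 1)) (μ (n + 1) - μ n) / 2)
    (hω : ∀ j, 0 ≤ ω j)
    (N : ℕ) (hN : 2 ≤ N)
    (hσ : sigmaN μ ω r N < ⊤)
    (z : ℂ)
    (hzRe : μ N - (μ N - μ (N - 1)) / 2 ≤ z.re)
    (hzk : ∀ k, 1 ≤ k → r k ≤ ‖z - (μ k : ℂ)‖) :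
    (∑' j : ℕ, if 1 ≤ j then ENNReal.ofReal (ω j ^ 2 / ‖z - (μ j : ℂ)‖) else 0)
      ≤ 2 * sigmaN μ ω r N := by
  have hsmono : StrictMonoOn μ (Set.Ici 1) := by
    refine strictMonoOn_of_lt_add_one Set.ordConnected_Ici fun n _ hn _ => hμmono n hn
  obtain ⟨n, hn, hmin⟩ := exists_nearest_of_tendsto_atTop hμtop N z.re
  have hnear : ∀ j, 1 ≤ j → |z.re - μ n| ≤ |z.re - μ j| := by
    intro j hj
    rcases le_or_gt N j with h | h
    · exact hmin j h
    · have hjN : μ j ≤ μ (N - 1) :=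
        hsmono.monotoneOn hj (show 1 ≤ N - 1 by omega) (by omega)
      have hlt : μ (N - 1) < μ N :=
        hsmono (show 1 ≤ N - 1 by omega) (show 1 ≤ N by omega) (by omega)
      refine (hmin N le_rfl).trans ((abs_le.2 ⟨?_, ?_⟩).trans (le_abs_self _)) <;> linarith
  have hre : ∀ j, |z.re - μ j| ≤ ‖z - (μ j : ℂ)‖ := fun j => by
    simpa using Complex.abs_re_le_norm (z - (μ j : ℂ))
  have hdist : ∀ j, 1 ≤ j → |μ n - μ j| ≤ 2 * ‖z - (μ j : ℂ)‖ := by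
    intro j hj
    have h := abs_sub_le (μ n) z.re (μ j)
    rw [abs_sub_comm (μ n) z.re] at h
    linarith [hnear j hj, hre j]
  have hrpos : 0 < r n := by
    have h1 := hμmono n (by omega)
    have h2 : μ (n - 1) < μ n :=
      hsmono (show 1 ≤ n - 1 by omega) (show 1 ≤ n by omega) (by omega)
    rw [hrn n (by omega)]
    exact half_pos (lt_min (sub_pos.2 h2) (sub_pos.2 h1))
  have hterm : ∀ j, (if 1 ≤ j then ENNReal.ofReal (ω j ^ 2 / ‖z - (μ j : ℂ)‖) else 0) ≤
      2 * (if 1 ≤ j ∧ j ≠ n then ENNReal.ofReal (ω j ^ 2 / |μ n - μ j|) else 0) +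
        (if j = n then ENNReal.ofReal (ω n ^ 2 / r n) else 0) := by
    intro j
    by_cases hj : 1 ≤ j
    · by_cases hjn : j = n
      · subst hjn
        simpa [hj] using ENNReal.ofReal_le_ofReal
          (div_le_div_of_nonneg_left (sq_nonneg (ω j)) hrpos (hzk j hj))
      · have hpos : 0 < |μ n - μ j| := abs_pos.2 <| sub_ne_zero.2 fun h =>
          hjn (hsmono.injOn hj (show 1 ≤ n by omega) h.symm)
        have hle : ω j ^ 2 / ‖z - (μ j : ℂ)‖ ≤ 2 * (ω j ^ 2 / |μ n - μ j|) := by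
          have hz : 0 < ‖z - (μ j : ℂ)‖ := by linarith [hdist j hj]
          rw [← mul_div_assoc, div_le_div_iff₀ hz hpos]
          nlinarith [mul_le_mul_of_nonneg_left (hdist j hj) (sq_nonneg (ω j))]
        simp only [hj, hjn, if_true, if_false, ne_eq, not_false_eq_true, and_self, add_zero]
        refine (ENNReal.ofReal_le_ofReal hle).trans_eq ?_
        rw [ENNReal.ofReal_mul zero_le_two, ENNReal.ofReal_ofNat]
    · simp [hj]
  calc _ ≤ _ := ENNReal.tsum_le_tsum hterm
    _ = 2 * (∑' j : ℕ, if 1 ≤ j ∧ j ≠ n then ENNReal.ofReal (ω j ^ 2 / |μ n - μ j|) else 0)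
          + ENNReal.ofReal (ω n ^ 2 / r n) := by
      rw [ENNReal.tsum_add, ENNReal.tsum_mul_left, tsum_ite_eq]
    _ ≤ 2 * ((∑' j : ℕ, if 1 ≤ j ∧ j ≠ n then ENNReal.ofReal (ω j ^ 2 / |μ n - μ j|) else 0)
          + ENNReal.ofReal (ω n ^ 2 / r n)) := by
      rw [mul_add]
      gcongr
      exact le_mul_of_one_le_left' one_le_two
    _ ≤ 2 * sigmaN μ ω r N := by
      gcongr
      exact le_iSup₂_of_le n hn le_rfl
end

section
/- For every fixed N ∈ ℕ and every ε > 0 there exists Y > 0 such that for every z ∈ ℂ with |Re z| ≤ μ_N, |Im z| ≥ Y, and |z − μ_k| ≥ r_k for all k ∈ ℕ, one has Σ_{j=1}^∞ ω_j²/|z − μ_j| ≤ ε. -/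
open scoped ENNReal

/-- A point far from the real axis, in the strip `|Re z| ≤ a`, stays at distance at least
`max Y (x / 2)` from `x`. -/
lemma max_le_norm_sub_ofReal {a x Y : ℝ} {z : ℂ} (ha : a ≤ Y) (hre : |z.re| ≤ a)
    (him : Y ≤ |z.im|) : max Y (x / 2) ≤ ‖z - (x : ℂ)‖ := by
  have h1 : Y ≤ ‖z - (x : ℂ)‖ := by
    have := Complex.abs_im_le_norm (z - (x : ℂ))
    simp only [Complex.sub_im, Complex.ofReal_im, sub_zero] at this
    linarith
  have h2 : x - a ≤ ‖z - (x : ℂ)‖ := by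
    have := Complex.abs_re_le_norm (z - (x : ℂ))
    simp only [Complex.sub_re, Complex.ofReal_re] at this
    linarith [neg_abs_le (z.re - x), le_abs_self z.re]
  exact max_le h1 (by linarith)

theorem statement1 (μ ω r : ℕ → ℝ)
    (hμ1 : 0 < μ 1)
    (hμmono : ∀ n, 1 ≤ n → μ n < μ (n + 1))
    (hμtop : Filter.Tendsto μ Filter.atTop Filter.atTop)
    (hr1 : r 1 = (μ 2 - μ 1) / 2)
    (hrn : ∀ n, 2 ≤ n → r n = min (μ n - μ (n - 1)) (μ (n + 1) - μ n) / 2)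
    (hω : ∀ j, 0 ≤ ω j)
    (hsum : (∑' j : ℕ, if 1 ≤ j then ENNReal.ofReal (ω j ^ 2 / μ j) else 0) < ⊤)
    (N : ℕ) (hN : 1 ≤ N) (ε : ℝ) (hε : 0 < ε) :
    ∃ Y > (0 : ℝ), ∀ z : ℂ, |z.re| ≤ μ N → Y ≤ |z.im| →
      (∀ k, 1 ≤ k → r k ≤ ‖z - (μ k : ℂ)‖) →
      (∑' j : ℕ, if 1 ≤ j then ENNReal.ofReal (ω j ^ 2 / ‖z - (μ j : ℂ)‖) else 0)
        ≤ ENNReal.ofReal ε := by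
  have hpos : ∀ j, 1 ≤ j → 0 < μ j := fun j hj => by
    induction j, hj using Nat.le_induction with
    | base => exact hμ1
    | succ n hn ih => exact ih.trans (hμmono n hn)
  have hf : Summable fun j : ℕ => if 1 ≤ j then ω j ^ 2 / μ j else 0 := by
    refine (ENNReal.summable_toReal hsum.ne).congr fun j => ?_
    split_ifs with hj
    · exact ENNReal.toReal_ofReal (div_nonneg (sq_nonneg _) (hpos j hj).le)
    · simp
  let g : ℝ → ℕ → ℝ := fun Y j => if 1 ≤ j then ω j ^ 2 / max Y (μ j / 2) else 0
  have hg0 : ∀ Y j, 0 ≤ g Y j := fun Y j => by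
    simp only [g]
    split_ifs with hj
    · exact div_nonneg (sq_nonneg _) (le_max_of_le_right (half_pos (hpos j hj)).le)
    · exact le_rfl
  have hgf : ∀ Y j, g Y j ≤ 2 * if 1 ≤ j then ω j ^ 2 / μ j else 0 := fun Y j => by
    simp only [g]
    split_ifs with hj
    · have := hpos j hj
      calc ω j ^ 2 / max Y (μ j / 2) ≤ ω j ^ 2 / (μ j / 2) := by
            gcongr
            exact le_max_right _ _
        _ = 2 * (ω j ^ 2 / μ j) := by field_simp
    · simp
  have hlim : Filter.Tendsto (fun Y => ∑' j, g Y j) Filter.atTop (nhds (∑' _ : ℕ, (0 : ℝ))) := by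
    refine tendsto_tsum_of_dominated_convergence (hf.mul_left 2) (fun j => ?_)
      (Filter.Eventually.of_forall fun Y j => ?_)
    · by_cases hj : 1 ≤ j
      · simp only [g, hj, if_true]
        exact Filter.Tendsto.const_div_atTop
          (Filter.tendsto_atTop_mono (fun Y => le_max_left _ _) Filter.tendsto_id) _
      · simp [g, hj]
    · rw [Real.norm_of_nonneg (hg0 Y j)]
      exact hgf Y j
  rw [tsum_zero] at hlim
  obtain ⟨Y, hYε, hYN⟩ :=
    ((hlim.eventually_le_const hε).and (Filter.eventually_ge_atTop (μ N))).exists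
  have hY : 0 < Y := (hpos N hN).trans_le hYN
  refine ⟨Y, hY, fun z hre him _ => ?_⟩
  calc (∑' j : ℕ, if 1 ≤ j then ENNReal.ofReal (ω j ^ 2 / ‖z - (μ j : ℂ)‖) else 0)
      ≤ ∑' j, ENNReal.ofReal (g Y j) := by
        refine ENNReal.tsum_le_tsum fun j => ?_
        simp only [g]
        split_ifs with hj
        · have := max_le_norm_sub_ofReal (x := μ j) hYN hre him
          have : 0 < max Y (μ j / 2) := lt_max_of_lt_left hY
          gcongr
        · exact zero_le
    _ = ENNReal.ofReal (∑' j, g Y j) :=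
        (ENNReal.ofReal_tsum_of_nonneg (hg0 Y)
          (Summable.of_nonneg_of_le (hg0 Y) (hgf Y) (hf.mul_left 2))).symm
    _ ≤ ENNReal.ofReal ε := ENNReal.ofReal_le_ofReal hYε
end

section
/- Let N ∈ ℕ be such that k_N (the largest k ≤ N with μ_N − r_N ≥ 2 μ_{k}) exists, assume σ_N < ∞, σ_{k_N} < ∞ and ρ_N < ∞, and let z_n ∈ ℂ with |z_n − μ_n| = r_n for each n ∈ ℕ. Then for all square-summable sequences x, y : ℕ → [0,∞) one has Σ_{n ≥ N} Σ_{k ∈ ℕ} (ω_n ω_k / |z_n − μ_k|) · x_k · y_n ≤ 2 ( σ_N · max{2 ρ_N, σ_{k_N}} )^{1/2} · (Σ_k x_k²)^{1/2} · (Σ_n y_n²)^{1/2}. -/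
open scoped ENNReal

/-- `ρ_N = Σ_{n ≥ N} ω_n²/μ_n`, valued in `[0,∞]`. -/
noncomputable def rhoN (μ ω : ℕ → ℝ) (N : ℕ) : ℝ≥0∞ :=
  ∑' n : ℕ, if N ≤ n then ENNReal.ofReal (ω n ^ 2 / μ n) else 0

/-- `k_N`, the largest `k ≤ N` (with `k ≥ 1`) such that `μ_N − r_N ≥ 2 μ_k`. -/
noncomputable def kN (μ r : ℕ → ℝ) (N : ℕ) : ℕ :=
  sSup {k : ℕ | 1 ≤ k ∧ k ≤ N ∧ 2 * μ k ≤ μ N - r N}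

theorem ENNReal.tsum_mul_le_sqrt_mul_sqrt {ι : Type*} (f g : ι → ℝ≥0∞) :
    ∑' i, f i * g i ≤ (∑' i, f i ^ 2) ^ (1/2 : ℝ) * (∑' i, g i ^ 2) ^ (1/2 : ℝ) := by
  let _ : MeasurableSpace ι := ⊤
  have h := ENNReal.lintegral_mul_le_Lp_mul_Lq (MeasureTheory.Measure.count : MeasureTheory.Measure ι)
    Real.HolderConjugate.two_two (f := f) (g := g)
    measurable_from_top.aemeasurable measurable_from_top.aemeasurable
  simpa [MeasureTheory.lintegral_count' measurable_from_top] using h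

/-- A weighted Schur test: the kernel `ω n * ω k / d n k` on the index set `S` is bounded on `ℓ²`
as soon as the weighted row and column sums are. -/
theorem schur_test_weighted (S : ℕ → ℕ → Prop) [∀ n k, Decidable (S n k)]
    (ω x y : ℕ → ℝ) (d : ℕ → ℕ → ℝ) (hω : ∀ j, 0 ≤ ω j) (hx : ∀ k, 0 ≤ x k)
    (hy : ∀ n, 0 ≤ y n) (hd : ∀ n k, 0 ≤ d n k) (P Q : ℕ → Prop) [DecidablePred P]
    [DecidablePred Q] (hP : ∀ n k, S n k → P n) (hQ : ∀ n k, S n k → Q k) (A B : ℝ≥0∞)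
    (hA : ∀ n, P n → (∑' k, if S n k then ENNReal.ofReal (ω k ^ 2 / d n k) else 0) ≤ A)
    (hB : ∀ k, Q k → (∑' n, if S n k then ENNReal.ofReal (ω n ^ 2 / d n k) else 0) ≤ B) :
    (∑' n, ∑' k, if S n k then ENNReal.ofReal (ω n * ω k / d n k * x k * y n) else 0)
      ≤ (A * B) ^ (1/2 : ℝ) * (∑' k, if Q k then ENNReal.ofReal (x k ^ 2) else 0) ^ (1/2 : ℝ)
        * (∑' n, if P n then ENNReal.ofReal (y n ^ 2) else 0) ^ (1/2 : ℝ) := by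
  let f : ℕ × ℕ → ℝ≥0∞ := fun p =>
    if S p.1 p.2 then ENNReal.ofReal (ω p.2 * y p.1 / √(d p.1 p.2)) else 0
  let g : ℕ × ℕ → ℝ≥0∞ := fun p =>
    if S p.1 p.2 then ENNReal.ofReal (ω p.1 * x p.2 / √(d p.1 p.2)) else 0
  have hfg : (∑' n, ∑' k, if S n k then ENNReal.ofReal (ω n * ω k / d n k * x k * y n) else 0)
      = ∑' p, f p * g p := by
    rw [ENNReal.tsum_prod']
    refine tsum_congr fun n => tsum_congr fun k => ?_
    by_cases h : S n k
    · have hf : 0 ≤ ω k * y n / √(d n k) :=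
        div_nonneg (mul_nonneg (hω _) (hy _)) (Real.sqrt_nonneg _)
      simp only [f, g, h, if_true]
      rw [← ENNReal.ofReal_mul hf, div_mul_div_comm, Real.mul_self_sqrt (hd n k)]
      congr 1
      ring
    · simp [f, g, h]
  have hf : ∑' p, f p ^ 2 ≤ A * ∑' n, if P n then ENNReal.ofReal (y n ^ 2) else 0 := by
    rw [ENNReal.tsum_prod', ← ENNReal.tsum_mul_left]
    refine ENNReal.tsum_le_tsum fun n => ?_
    by_cases hn : P n
    · rw [if_pos hn]
      refine le_trans (le_of_eq ?_) (mul_le_mul_left (hA n hn) _)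
      rw [← ENNReal.tsum_mul_right]
      refine tsum_congr fun k => ?_
      by_cases h : S n k
      · simp only [f, h, if_true]
        rw [← ENNReal.ofReal_mul (div_nonneg (sq_nonneg _) (hd n k)),
          ← ENNReal.ofReal_pow (div_nonneg (mul_nonneg (hω _) (hy _)) (Real.sqrt_nonneg _)),
          div_pow, Real.sq_sqrt (hd n k)]
        congr 1
        ring
      · simp [f, h]
    · have h : ∀ k, ¬ S n k := fun k h => hn (hP n k h)
      simp [f, h]
  have hg : ∑' p, g p ^ 2 ≤ B * ∑' k, if Q k then ENNReal.ofReal (x k ^ 2) else 0 := by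
    rw [ENNReal.tsum_prod', ENNReal.tsum_comm, ← ENNReal.tsum_mul_left]
    refine ENNReal.tsum_le_tsum fun k => ?_
    by_cases hk : Q k
    · rw [if_pos hk]
      refine le_trans (le_of_eq ?_) (mul_le_mul_left (hB k hk) _)
      rw [← ENNReal.tsum_mul_right]
      refine tsum_congr fun n => ?_
      by_cases h : S n k
      · simp only [g, h, if_true]
        rw [← ENNReal.ofReal_mul (div_nonneg (sq_nonneg _) (hd n k)),
          ← ENNReal.ofReal_pow (div_nonneg (mul_nonneg (hω _) (hx _)) (Real.sqrt_nonneg _)),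
          div_pow, Real.sq_sqrt (hd n k)]
        congr 1
        ring
      · simp [g, h]
    · have h : ∀ n, ¬ S n k := fun n h => hk (hQ n k h)
      simp [g, h]
  rw [hfg]
  refine (ENNReal.tsum_mul_le_sqrt_mul_sqrt f g).trans ?_
  refine (mul_le_mul' (ENNReal.rpow_le_rpow hf (by norm_num))
    (ENNReal.rpow_le_rpow hg (by norm_num))).trans (le_of_eq ?_)
  simp only [ENNReal.mul_rpow_of_nonneg _ _ (show (0 : ℝ) ≤ 1/2 by norm_num)]
  ring

theorem ENNReal.ofReal_div_le_two_mul {a b c : ℝ} (ha : 0 ≤ a) (hb : 0 < b) (h : b ≤ 2 * c) :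
    ENNReal.ofReal (a / c) ≤ 2 * ENNReal.ofReal (a / b) := by
  rw [← ENNReal.ofReal_ofNat 2, ← ENNReal.ofReal_mul (by norm_num)]
  refine ENNReal.ofReal_le_ofReal ?_
  rw [← mul_div_assoc, div_le_div_iff₀ (by linarith) hb]
  nlinarith

/-- The sum defining `sigmaN` controls, up to a factor `2`, every subsum with denominators
at least half as large. -/
theorem tsum_le_two_mul_sigmaN (μ ω r : ℕ → ℝ) (M m : ℕ) (hM : M ≤ m) (hr : 0 < r m)
    (hμ : ∀ j, 1 ≤ j → j ≠ m → μ j ≠ μ m)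
    (T : ℕ → Prop) [DecidablePred T] (hT : ∀ j, T j → 1 ≤ j) (d : ℕ → ℝ)
    (hd : ∀ j, T j → j ≠ m → |μ m - μ j| ≤ 2 * d j) (hdm : T m → r m ≤ d m) :
    (∑' j, if T j then ENNReal.ofReal (ω j ^ 2 / d j) else 0) ≤ 2 * sigmaN μ ω r M := by
  have h1 : (∑' j, if T j then ENNReal.ofReal (ω j ^ 2 / d j) else 0) ≤
      ∑' j, (2 * (if 1 ≤ j ∧ j ≠ m then ENNReal.ofReal (ω j ^ 2 / |μ m - μ j|) else 0)
        + 2 * (if j = m then ENNReal.ofReal (ω m ^ 2 / r m) else 0)) := by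
    refine ENNReal.tsum_le_tsum fun j => ?_
    by_cases hj : T j
    · rw [if_pos hj]
      by_cases hjm : j = m
      · subst hjm
        simpa using ENNReal.ofReal_div_le_two_mul (sq_nonneg (ω j)) hr (by linarith [hdm hj])
      · have hpos : 0 < |μ m - μ j| := abs_pos.2 (sub_ne_zero.2 (hμ j (hT j hj) hjm).symm)
        simpa [hjm, hT j hj] using
          ENNReal.ofReal_div_le_two_mul (sq_nonneg (ω j)) hpos (hd j hj hjm)
    · simp [hj]
  refine h1.trans ?_
  rw [ENNReal.tsum_add, ENNReal.tsum_mul_left, ENNReal.tsum_mul_left, tsum_ite_eq, ← mul_add]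
  exact mul_le_mul_right (le_iSup₂_of_le (f := fun n (_ : M ≤ n) =>
    ((∑' j : ℕ, if 1 ≤ j ∧ j ≠ n then ENNReal.ofReal (ω j ^ 2 / |μ n - μ j|) else 0)
      + ENNReal.ofReal (ω n ^ 2 / r n))) m hM le_rfl) 2

theorem statement5 (μ ω r : ℕ → ℝ)
    (hμ1 : 0 < μ 1)
    (hμmono : ∀ n, 1 ≤ n → μ n < μ (n + 1))
    (hμtop : Filter.Tendsto μ Filter.atTop Filter.atTop)
    (hr1 : r 1 = (μ 2 - μ 1) / 2)
    (hrn : ∀ n, 2 ≤ n → r n = min (μ n - μ (n - 1)) (μ (n + 1) - μ n) / 2)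
    (hω : ∀ j, 0 ≤ ω j)
    (N : ℕ)
    (hkex : {k : ℕ | 1 ≤ k ∧ k ≤ N ∧ 2 * μ k ≤ μ N - r N}.Nonempty)
    (hσN : sigmaN μ ω r N < ⊤)
    (hσk : sigmaN μ ω r (kN μ r N) < ⊤)
    (hρ : rhoN μ ω N < ⊤)
    (z : ℕ → ℂ)
    (hz : ∀ n, 1 ≤ n → ‖z n - (μ n : ℂ)‖ = r n)
    (x y : ℕ → ℝ) (hx0 : ∀ k, 0 ≤ x k) (hy0 : ∀ n, 0 ≤ y n)
    (hx2 : Summable fun k => x k ^ 2) (hy2 : Summable fun n => y n ^ 2) :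
    (∑' n : ℕ, ∑' k : ℕ,
        if N ≤ n ∧ 1 ≤ k then
          ENNReal.ofReal (ω n * ω k / ‖z n - (μ k : ℂ)‖ * x k * y n) else 0)
      ≤ 2 * (sigmaN μ ω r N * max (2 * rhoN μ ω N) (sigmaN μ ω r (kN μ r N))) ^ (1/2 : ℝ)
        * (∑' k : ℕ, if 1 ≤ k then ENNReal.ofReal (x k ^ 2) else 0) ^ (1/2 : ℝ)
        * (∑' n : ℕ, if 1 ≤ n then ENNReal.ofReal (y n ^ 2) else 0) ^ (1/2 : ℝ) := by
  have hlt : ∀ i j, 1 ≤ i → i < j → μ i < μ j := by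
    intro i j hi hij
    induction j, hij using Nat.le_induction with
    | base => exact hμmono i hi
    | succ j hj ih => exact ih.trans (hμmono j (by omega))
  have hle : ∀ i j, 1 ≤ i → i ≤ j → μ i ≤ μ j := by
    intro i j hi hij
    rcases hij.eq_or_lt with rfl | h
    · exact le_rfl
    · exact (hlt i j hi h).le
  have hne : ∀ i j, 1 ≤ i → 1 ≤ j → i ≠ j → μ i ≠ μ j := by
    intro i j hi hj hij
    rcases lt_or_gt_of_ne hij with h | h
    · exact (hlt i j hi h).ne
    · exact (hlt j i hj h).ne'
  have hr_up : ∀ n, 1 ≤ n → 2 * r n ≤ μ (n + 1) - μ n := by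
    intro n hn
    rcases hn.eq_or_lt with rfl | h
    · rw [hr1]; exact (mul_div_cancel₀ _ two_ne_zero).le
    · rw [hrn n h]; linarith [min_le_right (μ n - μ (n - 1)) (μ (n + 1) - μ n)]
  have hr_down : ∀ n, 2 ≤ n → 2 * r n ≤ μ n - μ (n - 1) := by
    intro n h
    rw [hrn n h]; linarith [min_le_left (μ n - μ (n - 1)) (μ (n + 1) - μ n)]
  have hrpos : ∀ n, 1 ≤ n → 0 < r n := by
    intro n hn
    rcases hn.eq_or_lt with rfl | h
    · rw [hr1]; linarith [hμmono 1 le_rfl]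
    · rw [hrn n h]
      have h1 := hlt (n - 1) n (by omega) (by omega)
      have h2 := hμmono n hn
      exact half_pos (lt_min (by linarith) (by linarith))
  have hr_le : ∀ n k, 1 ≤ n → 1 ≤ k → k ≠ n → 2 * r n ≤ |μ n - μ k| := by
    intro n k hn hk hkn
    rcases lt_or_gt_of_ne hkn with h | h
    · have := hle k (n - 1) hk (by omega)
      exact le_trans (by linarith [hr_down n (by omega)]) (le_abs_self _)
    · have := hle (n + 1) k (by omega) h
      exact le_trans (by linarith [hr_up n hn]) (neg_le_abs _)
  have hz_sub : ∀ n k, 1 ≤ n → |μ n - μ k| - r n ≤ ‖z n - (μ k : ℂ)‖ := by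
    intro n k hn
    have h := norm_sub_norm_le ((μ n : ℂ) - μ k) ((μ n : ℂ) - z n)
    rw [sub_sub_sub_cancel_left, norm_sub_rev (μ n : ℂ) (z n), hz n hn, ← Complex.ofReal_sub,
      Complex.norm_real, Real.norm_eq_abs] at h
    exact h
  have hz_half : ∀ n k, 1 ≤ n → 1 ≤ k → k ≠ n → |μ n - μ k| ≤ 2 * ‖z n - (μ k : ℂ)‖ := by
    intro n k hn hk hkn
    linarith [hz_sub n k hn, hr_le n k hn hk hkn]
  have hbdd : BddAbove {k : ℕ | 1 ≤ k ∧ k ≤ N ∧ 2 * μ k ≤ μ N - r N} := ⟨N, fun k hk => hk.2.1⟩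
  obtain ⟨hk1, hkN, hk2⟩ : 1 ≤ kN μ r N ∧ kN μ r N ≤ N ∧ 2 * μ (kN μ r N) ≤ μ N - r N :=
    Nat.sSup_mem hkex hbdd
  have hN1 : 1 ≤ N := hk1.trans hkN
  have hN2 : 2 ≤ N := by
    by_contra h
    have hN : N = 1 := by omega
    subst hN
    have hk : kN μ r 1 = 1 := by omega
    rw [hk] at hk2
    linarith [hrpos 1 le_rfl]
  have hpos : ∀ n, 1 ≤ n → 0 < μ n := fun n hn => hμ1.trans_le (hle 1 n le_rfl hn)
  have hsub : ∀ n, N ≤ n → μ N - r N ≤ μ n - r n := by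
    intro n hn
    rcases hn.eq_or_lt with rfl | h
    · exact le_rfl
    · linarith [hr_down n (by omega), hle N (n - 1) hN1 (by omega), hle (n - 1) n (by omega)
        (by omega), hrpos N hN1]
  have hA : ∀ n, N ≤ n → (∑' k, if N ≤ n ∧ 1 ≤ k then
      ENNReal.ofReal (ω k ^ 2 / ‖z n - (μ k : ℂ)‖) else 0) ≤ 2 * sigmaN μ ω r N := by
    intro n hn
    have hn1 : 1 ≤ n := hN1.trans hn
    exact tsum_le_two_mul_sigmaN μ ω r N n hn (hrpos n hn1)
      (fun j hj hjn => hne j n hj hn1 hjn) _ (fun j hj => hj.2) _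
      (fun j hj hjn => hz_half n j hn1 hj.2 hjn) (fun _ => (hz n hn1).ge)
  have hB : ∀ k, 1 ≤ k → (∑' n, if N ≤ n ∧ 1 ≤ k then
      ENNReal.ofReal (ω n ^ 2 / ‖z n - (μ k : ℂ)‖) else 0)
      ≤ 2 * max (2 * rhoN μ ω N) (sigmaN μ ω r (kN μ r N)) := by
    intro k hk
    rcases le_total k (kN μ r N) with h | h
    · refine le_trans ?_ (mul_le_mul_right (le_max_left _ _) 2)
      rw [rhoN, ← ENNReal.tsum_mul_left, ← ENNReal.tsum_mul_left]
      refine ENNReal.tsum_le_tsum fun n => ?_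
      by_cases hn : N ≤ n
      · have hn1 : 1 ≤ n := hN1.trans hn
        rw [if_pos ⟨hn, hk⟩, if_pos hn]
        have h1 : μ n ≤ 2 * (2 * ‖z n - (μ k : ℂ)‖) := by
          linarith [hz_sub n k hn1, le_abs_self (μ n - μ k), hsub n hn, hle k _ hk h,
            hr_down n (by omega), hpos (n - 1) (by omega)]
        have h2 : 0 < 2 * ‖z n - (μ k : ℂ)‖ := by linarith [hpos n hn1]
        exact (ENNReal.ofReal_div_le_two_mul (sq_nonneg _) h2 le_rfl).trans
          (mul_le_mul_right (ENNReal.ofReal_div_le_two_mul (sq_nonneg _) (hpos n hn1) h1) 2)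
      · simp [hn]
    · refine le_trans ?_ (mul_le_mul_right (le_max_right _ _) 2)
      refine tsum_le_two_mul_sigmaN μ ω r (kN μ r N) k h (hrpos k hk)
        (fun j hj hjk => hne j k hj hk hjk) _ (fun j hj => hN1.trans hj.1) _
        (fun j hj hjk => ?_) (fun _ => (hz k hk).ge)
      rw [abs_sub_comm]
      exact hz_half j k (hN1.trans hj.1) hk hjk.symm
  refine (schur_test_weighted (fun n k => N ≤ n ∧ 1 ≤ k) ω x y (fun n k => ‖z n - (μ k : ℂ)‖)
    hω hx0 hy0 (fun _ _ => norm_nonneg _) (fun n => N ≤ n) (fun k => 1 ≤ k)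
    (fun _ _ h => h.1) (fun _ _ h => h.2) _ _ hA hB).trans ?_
  have hc : ∀ a b : ℝ≥0∞, (2 * a * (2 * b)) ^ (1/2 : ℝ) = 2 * (a * b) ^ (1/2 : ℝ) := by
    intro a b
    rw [show 2 * a * (2 * b) = (2 : ℝ≥0∞) ^ (2 : ℝ) * (a * b) by rw [ENNReal.rpow_two]; ring,
      ENNReal.mul_rpow_of_nonneg _ _ (by norm_num), ← ENNReal.rpow_mul]
    norm_num
  rw [hc]
  refine mul_le_mul_right (ENNReal.rpow_le_rpow (ENNReal.tsum_le_tsum fun n => ?_)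
    (by norm_num)) _
  by_cases hn : N ≤ n
  · simp [hn, hN1.trans hn]
  · simp [hn]
end

section
/- Let μ : ℕ → ℝ with μ_j > 0 for all j, let ω : ℕ → [0,∞) satisfy Σ_j ω_j²/μ_j < ∞, and let v : ℕ × ℕ → ℂ satisfy |v_{jk}| ≤ ω_j ω_k for all j, k. Then: (i) for every z₀ ≥ 0 and every f : ℕ → ℂ with Σ_j μ_j |f_j|² < ∞ and Σ_j |f_j|² < ∞, one has Σ_{j,k} |v_{jk}| |f_j| |f_k| ≤ ( Σ_j ω_j²/(μ_j + z₀) ) · ( Σ_j μ_j |f_j|² + z₀ Σ_j |f_j|² ); and (ii) for every ε > 0 there exists C_ε > 0 such that for every such f, Σ_{j,k} |v_{jk}| |f_j| |f_k| ≤ ε · ( Σ_j μ_j |f_j|² + C_ε Σ_j |f_j|² ). -/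
open scoped ENNReal

/-- Cauchy–Schwarz for the square of a series whose terms satisfy `r i ^ 2 = a i * b i`. -/
lemma ENNReal.tsum_ofReal_sq_le_of_sq_eq_mul {ι : Type*} {r a b : ι → ℝ}
    (hr : ∀ i, 0 ≤ r i) (ha : ∀ i, 0 ≤ a i) (hb : ∀ i, 0 ≤ b i)
    (hab : ∀ i, r i ^ 2 = a i * b i) (hsa : Summable a) (hsb : Summable b) :
    (∑' i, ENNReal.ofReal (r i)) ^ 2 ≤ ENNReal.ofReal ((∑' i, a i) * ∑' i, b i) := by
  have hnonneg : 0 ≤ (∑' i, a i) * ∑' i, b i := mul_nonneg (tsum_nonneg ha) (tsum_nonneg hb)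
  have hle : ∑' i, ENNReal.ofReal (r i) ≤ ENNReal.ofReal (√((∑' i, a i) * ∑' i, b i)) := by
    rw [ENNReal.tsum_eq_iSup_sum]
    refine iSup_le fun s => ?_
    rw [← ENNReal.ofReal_sum_of_nonneg fun i _ => hr i]
    refine ENNReal.ofReal_le_ofReal (Real.le_sqrt_of_sq_le ?_)
    calc (∑ i ∈ s, r i) ^ 2 ≤ (∑ i ∈ s, a i) * ∑ i ∈ s, b i :=
          Finset.sum_sq_le_sum_mul_sum_of_sq_le_mul s (fun i _ => ha i) (fun i _ => hb i)
            fun i _ => (hab i).le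
      _ ≤ (∑' i, a i) * ∑' i, b i :=
          mul_le_mul (hsa.sum_le_tsum s fun i _ => ha i) (hsb.sum_le_tsum s fun i _ => hb i)
            (Finset.sum_nonneg fun i _ => hb i) (tsum_nonneg ha)
  calc (∑' i, ENNReal.ofReal (r i)) ^ 2
      ≤ ENNReal.ofReal (√((∑' i, a i) * ∑' i, b i)) ^ 2 := by gcongr
    _ = ENNReal.ofReal ((∑' i, a i) * ∑' i, b i) := by
        rw [← ENNReal.ofReal_pow (Real.sqrt_nonneg _), Real.sq_sqrt hnonneg]

/-- A double series dominated by a product of series is at most the square of the series. -/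
lemma ENNReal.tsum_prod_le_tsum_sq {ι : Type*} {F : ι × ι → ℝ≥0∞} {r : ι → ℝ≥0∞}
    (h : ∀ i j, F (i, j) ≤ r i * r j) : ∑' p, F p ≤ (∑' i, r i) ^ 2 := by
  calc ∑' p, F p ≤ ∑' p : ι × ι, r p.1 * r p.2 := ENNReal.tsum_le_tsum fun p => h p.1 p.2
    _ = (∑' i, r i) ^ 2 := by
        rw [ENNReal.tsum_prod (f := fun i j => r i * r j)]
        simp_rw [ENNReal.tsum_mul_left, ENNReal.tsum_mul_right]
        rw [sq]

lemma div_add_nonneg_le_div {x m z : ℝ} (hx : 0 ≤ x) (hm : 0 < m) (hz : 0 ≤ z) :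
    x / (m + z) ≤ x / m :=
  div_le_div_of_nonneg_left hx hm (by linarith)

/-- The resolvent-type sum `∑ ωⱼ² / (μⱼ + z)` vanishes as `z → ∞`. -/
lemma tendsto_tsum_sq_div_add_atTop {μ ω : ℕ → ℝ} (hμ : ∀ j, 1 ≤ j → 0 < μ j)
    (hsum : Summable fun j : ℕ => if 1 ≤ j then ω j ^ 2 / μ j else 0) :
    Filter.Tendsto (fun z : ℝ => ∑' j : ℕ, if 1 ≤ j then ω j ^ 2 / (μ j + z) else 0)
      Filter.atTop (nhds 0) := by
  rw [← tsum_zero (α := ℝ) (β := ℕ)]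
  refine tendsto_tsum_of_dominated_convergence hsum (fun j => ?_) ?_
  · by_cases hj : 1 ≤ j
    · simp only [if_pos hj]
      exact tendsto_const_nhds.div_atTop (Filter.tendsto_atTop_add_const_left _ _ Filter.tendsto_id)
    · simp [if_neg hj]
  · filter_upwards [Filter.eventually_ge_atTop (0 : ℝ)] with z hz j
    by_cases hj : 1 ≤ j
    · have := hμ j hj
      simp only [if_pos hj]
      rw [Real.norm_of_nonneg (by positivity)]
      exact div_add_nonneg_le_div (sq_nonneg _) this hz
    · simp [if_neg hj]

lemma tsum_quadratic_form_le {μ ω : ℕ → ℝ} {v : ℕ → ℕ → ℂ}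
    (hμ : ∀ j, 1 ≤ j → 0 < μ j) (hω : ∀ j, 0 ≤ ω j)
    (hsum : Summable fun j : ℕ => if 1 ≤ j then ω j ^ 2 / μ j else 0)
    (hv : ∀ j k, 1 ≤ j → 1 ≤ k → ‖v j k‖ ≤ ω j * ω k)
    {z : ℝ} (hz : 0 ≤ z) {f : ℕ → ℂ}
    (h₁ : Summable (fun j : ℕ => if 1 ≤ j then μ j * ‖f j‖ ^ 2 else 0))
    (h₂ : Summable (fun j : ℕ => if 1 ≤ j then ‖f j‖ ^ 2 else 0)) :
    (∑' p : ℕ × ℕ, if 1 ≤ p.1 ∧ 1 ≤ p.2 then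
        ENNReal.ofReal (‖v p.1 p.2‖ * ‖f p.1‖ * ‖f p.2‖) else 0)
      ≤ ENNReal.ofReal
          ((∑' j : ℕ, if 1 ≤ j then ω j ^ 2 / (μ j + z) else 0) *
            ((∑' j : ℕ, if 1 ≤ j then μ j * ‖f j‖ ^ 2 else 0)
              + z * ∑' j : ℕ, if 1 ≤ j then ‖f j‖ ^ 2 else 0)) := by
  have ha : ∀ j : ℕ, 0 ≤ if 1 ≤ j then ω j ^ 2 / (μ j + z) else 0 := fun j => by
    split_ifs with hj
    · have := hμ j hj
      positivity
    · rfl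
  have hsa : Summable fun j : ℕ => if 1 ≤ j then ω j ^ 2 / (μ j + z) else 0 := by
    refine hsum.of_nonneg_of_le ha fun j => ?_
    split_ifs with hj
    · exact div_add_nonneg_le_div (sq_nonneg _) (hμ j hj) hz
    · rfl
  rw [← tsum_mul_left, ← h₁.tsum_add (h₂.mul_left z)]
  refine le_trans (ENNReal.tsum_prod_le_tsum_sq
    (r := fun j => ENNReal.ofReal (if 1 ≤ j then ω j * ‖f j‖ else 0)) fun j k => ?_)
    (ENNReal.tsum_ofReal_sq_le_of_sq_eq_mul (fun j => ?_) ha (fun j => ?_) (fun j => ?_) hsa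
      (h₁.add (h₂.mul_left z)))
  · by_cases h : 1 ≤ j ∧ 1 ≤ k
    · simp only [if_pos h, if_pos h.1, if_pos h.2]
      rw [← ENNReal.ofReal_mul (mul_nonneg (hω j) (norm_nonneg _))]
      refine ENNReal.ofReal_le_ofReal ?_
      calc ‖v j k‖ * ‖f j‖ * ‖f k‖ ≤ ω j * ω k * ‖f j‖ * ‖f k‖ := by
            gcongr
            exact hv j k h.1 h.2
        _ = ω j * ‖f j‖ * (ω k * ‖f k‖) := by ring
    · simp [if_neg h]
  · split_ifs
    · exact mul_nonneg (hω j) (norm_nonneg _)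
    · rfl
  · split_ifs with hj
    · have := hμ j hj
      positivity
    · simp
  · split_ifs with hj
    · have := hμ j hj
      have : μ j + z ≠ 0 := by positivity
      field_simp
    · simp

theorem statement17 (μ ω : ℕ → ℝ) (v : ℕ → ℕ → ℂ)
    (hμ : ∀ j, 1 ≤ j → 0 < μ j)
    (hω : ∀ j, 0 ≤ ω j)
    (hsum : Summable fun j : ℕ => if 1 ≤ j then ω j ^ 2 / μ j else 0)
    (hv : ∀ j k, 1 ≤ j → 1 ≤ k → ‖v j k‖ ≤ ω j * ω k) :
    (∀ z₀ : ℝ, 0 ≤ z₀ → ∀ f : ℕ → ℂ,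
      Summable (fun j : ℕ => if 1 ≤ j then μ j * ‖f j‖ ^ 2 else 0) →
      Summable (fun j : ℕ => if 1 ≤ j then ‖f j‖ ^ 2 else 0) →
      (∑' p : ℕ × ℕ, if 1 ≤ p.1 ∧ 1 ≤ p.2 then
          ENNReal.ofReal (‖v p.1 p.2‖ * ‖f p.1‖ * ‖f p.2‖)
        else 0)
        ≤ ENNReal.ofReal
            ((∑' j : ℕ, if 1 ≤ j then ω j ^ 2 / (μ j + z₀) else 0) *
              ((∑' j : ℕ, if 1 ≤ j then μ j * ‖f j‖ ^ 2 else 0)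
                + z₀ * ∑' j : ℕ, if 1 ≤ j then ‖f j‖ ^ 2 else 0)))
    ∧
    (∀ ε : ℝ, 0 < ε → ∃ C > (0 : ℝ), ∀ f : ℕ → ℂ,
      Summable (fun j : ℕ => if 1 ≤ j then μ j * ‖f j‖ ^ 2 else 0) →
      Summable (fun j : ℕ => if 1 ≤ j then ‖f j‖ ^ 2 else 0) →
      (∑' p : ℕ × ℕ, if 1 ≤ p.1 ∧ 1 ≤ p.2 then
          ENNReal.ofReal (‖v p.1 p.2‖ * ‖f p.1‖ * ‖f p.2‖)
        else 0)
        ≤ ENNReal.ofReal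
            (ε * ((∑' j : ℕ, if 1 ≤ j then μ j * ‖f j‖ ^ 2 else 0)
                + C * ∑' j : ℕ, if 1 ≤ j then ‖f j‖ ^ 2 else 0))) := by
  refine ⟨fun z hz f h₁ h₂ => tsum_quadratic_form_le hμ hω hsum hv hz h₁ h₂, fun ε hε => ?_⟩
  obtain ⟨C, hlt, hC⟩ := (((tendsto_tsum_sq_div_add_atTop hμ hsum).eventually_lt_const hε).and
    (Filter.eventually_gt_atTop 0)).exists
  refine ⟨C, hC, fun f h₁ h₂ => (tsum_quadratic_form_le hμ hω hsum hv hC.le h₁ h₂).trans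
    (ENNReal.ofReal_le_ofReal (mul_le_mul_of_nonneg_right hlt.le ?_))⟩
  refine add_nonneg (tsum_nonneg fun j => ?_) (mul_nonneg hC.le (tsum_nonneg fun j => ?_))
  · split_ifs with hj
    · exact mul_nonneg (hμ j hj).le (sq_nonneg _)
    · rfl
  · split_ifs
    · exact sq_nonneg _
    · rfl
end
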